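/- Let a ∈ H^∞ and λ ∈ ℂ with |λ| < 1/‖a‖_∞. Then multiplication by 1/(1 − \bar{λ}a) maps M(\bar{a}) onto M(\bar{a}): (1 − \bar{λ}a)^{-1} M(\bar{a}) = M(\bar{a}). -/

import Mathlib

open Complex Set

noncomputable section

/-- The open unit disk in `ℂ`. -/
def unitDisk : Set ℂ := Metric.ball 0 1

/-- The `n`-th Taylor coefficient of `f` at `0`. -/
def coef (f : ℂ → ℂ) (n : ℕ) : ℂ := iteratedDeriv n f 0 / (n.factorial : ℂ)

/-- `f` belongs to the Hardy space `H²` of the unit disk. -/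
def MemH2 (f : ℂ → ℂ) : Prop :=
  DifferentiableOn ℂ f unitDisk ∧ Summable fun n => ‖coef f n‖ ^ 2

/-- The `H²` norm. -/
def norm2 (f : ℂ → ℂ) : ℝ := Real.sqrt (∑' n, ‖coef f n‖ ^ 2)

/-- The `H²` inner product. -/
def inner2 (f g : ℂ → ℂ) : ℂ := ∑' n, coef f n * (starRingEnd ℂ) (coef g n)

/-- `f` belongs to `H^∞`: bounded and analytic on the unit disk. -/
def MemHinf (f : ℂ → ℂ) : Prop :=
  DifferentiableOn ℂ f unitDisk ∧ ∃ C, ∀ z ∈ unitDisk, ‖f z‖ ≤ C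

/-- The `H^∞` (sup) norm. -/
def normInf (f : ℂ → ℂ) : ℝ := sSup ((fun z => ‖f z‖) '' unitDisk)

/-- The co-analytic Toeplitz operator `T_{\bar a}` in terms of Taylor
coefficients: the `n`-th coefficient of `T_{\bar a} f` is
`∑ₖ conj (â k) * f̂ (n + k)`. -/
def Tbar (a f : ℂ → ℂ) : ℂ → ℂ :=
  fun z => ∑' n : ℕ, (∑' k : ℕ, (starRingEnd ℂ) (coef a k) * coef f (n + k)) * z ^ n

/-- Membership in the range space `M(ā) = T_{\bar a} H²` (as functions on the disk). -/
def MemMbar (a g : ℂ → ℂ) : Prop :=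
  ∃ f, MemH2 f ∧ Set.EqOn g (Tbar a f) unitDisk

/-- The range norm on `M(ā)`: `‖T_{\bar a} f‖_{ā} = ‖f‖_{H²}`. -/
def normMbar (a g : ℂ → ℂ) : ℝ :=
  sInf {r | ∃ f, MemH2 f ∧ Set.EqOn g (Tbar a f) unitDisk ∧ r = norm2 f}

/-- `a` is outer: the analytic Toeplitz operator `T_a` (multiplication by `a`)
has dense range in `H²`. -/
def Outer (a : ℂ → ℂ) : Prop :=
  ∀ g, MemH2 g → ∀ ε > 0, ∃ f, MemH2 f ∧ norm2 (fun z => g z - a z * f z) < ε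

/-- `u` is inner: multiplication by `u` is isometric on `H²`. -/
def IsInner (u : ℂ → ℂ) : Prop :=
  MemHinf u ∧ ∀ f, MemH2 f → norm2 (fun z => u z * f z) = norm2 f

/-- `p` is (given by) a polynomial of degree `< N`, i.e. of degree at most `N - 1`. -/
def MemPoly (N : ℕ) (p : ℂ → ℂ) : Prop :=
  ∃ q : Polynomial ℂ, q.degree < (N : WithBot ℕ) ∧ ∀ z, p z = q.eval z

/-- `φ` is a multiplier from `M(ā₁)` to `M(ā₂)`. -/
def Mult (a₁ a₂ φ : ℂ → ℂ) : Prop :=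
  DifferentiableOn ℂ φ unitDisk ∧
    ∀ f, MemMbar a₁ f → MemMbar a₂ fun z => φ z * f z

/-- The backward shift `B f = (f - f 0) / z`. -/
def Bshift (f : ℂ → ℂ) : ℂ → ℂ :=
  fun z => if z = 0 then deriv f 0 else (f z - f 0) / z


lemma coef_hasSum {f : ℂ → ℂ} (hf : DifferentiableOn ℂ f unitDisk) {z : ℂ} (hz : z ∈ unitDisk) :
    HasSum (fun n => coef f n * z ^ n) (f z) := by
  have h := Complex.hasSum_taylorSeries_on_ball hf hz
  simpa [coef, div_eq_mul_inv, mul_comm, mul_left_comm] using h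

lemma hasFPowerSeriesOnBall_of_hasSum {c : ℕ → ℂ} {f : ℂ → ℂ}
    (h : ∀ z ∈ unitDisk, HasSum (fun n => c n * z ^ n) (f z)) :
    HasFPowerSeriesOnBall f (FormalMultilinearSeries.ofScalars ℂ c) 0 1 where
  r_le := by
    refine ENNReal.le_of_forall_nnreal_lt fun r hr => ?_
    refine FormalMultilinearSeries.le_radius_of_tendsto _ (l := 0) ?_
    have hr' : (r : ℂ) ∈ unitDisk := by
      simpa [unitDisk] using hr
    simpa using (h _ hr').summable.tendsto_atTop_zero.norm
  r_pos := one_pos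
  hasSum := by
    intro y hy
    have hy' : y ∈ unitDisk := by
      rw [← ENNReal.ofReal_one, Metric.eball_ofReal] at hy
      exact hy
    simpa [FormalMultilinearSeries.ofScalars_apply_eq, mul_comm] using h y hy'

lemma differentiableOn_of_hasSum {c : ℕ → ℂ} {f : ℂ → ℂ}
    (h : ∀ z ∈ unitDisk, HasSum (fun n => c n * z ^ n) (f z)) :
    DifferentiableOn ℂ f unitDisk := by
  have := (hasFPowerSeriesOnBall_of_hasSum h).differentiableOn
  rwa [← ENNReal.ofReal_one, Metric.eball_ofReal] at this

lemma unitDisk_mem_nhds : unitDisk ∈ nhds (0 : ℂ) := Metric.ball_mem_nhds _ one_pos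

lemma coef_eq_of_hasSum {c : ℕ → ℂ} {f : ℂ → ℂ}
    (h : ∀ z ∈ unitDisk, HasSum (fun n => c n * z ^ n) (f z)) : coef f = c := by
  have h1 := (hasFPowerSeriesOnBall_of_hasSum h).hasFPowerSeriesAt
  have h2 := h1.analyticAt.hasFPowerSeriesAt
  funext n
  simpa [coef] using congr_arg (FormalMultilinearSeries.coeff · n) (h2.eq_formalMultilinearSeries h1)

lemma coef_mul {f g : ℂ → ℂ} (hf : DifferentiableOn ℂ f unitDisk)
    (hg : DifferentiableOn ℂ g unitDisk) (n : ℕ) :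
    coef (fun z => f z * g z) n = ∑ i ∈ Finset.range (n + 1), coef f i * coef g (n - i) := by
  have hf' : ContDiffAt ℂ n f 0 := (hf.analyticAt unitDisk_mem_nhds).contDiffAt
  have hg' : ContDiffAt ℂ n g 0 := (hg.analyticAt unitDisk_mem_nhds).contDiffAt
  simp only [coef]
  rw [iteratedDeriv_fun_mul hf' hg', Finset.sum_div]
  refine Finset.sum_congr rfl fun i hi ↦ ?_
  rw [Nat.cast_choose _ (by grind)]
  field_simp [Nat.factorial_ne_zero]

lemma parseval {c : ℕ → ℂ} {φ : ℂ → ℂ} (hc : Summable fun n => ‖c n‖)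
    (hφ : ∀ z : ℂ, ‖z‖ = 1 → HasSum (fun n => c n * z ^ n) (φ z)) :
    HasSum (fun n => ‖c n‖ ^ 2) (Real.circleAverage (fun z => ‖φ z‖ ^ 2) 0 1) := by
  rw [hasSum_iff_tendsto_nat_of_nonneg fun n => by positivity]
  let p : ℕ → Polynomial ℂ := fun N => ∑ n ∈ Finset.range N, Polynomial.monomial n (c n)
  have hev : ∀ N z, (p N).eval z = ∑ n ∈ Finset.range N, c n * z ^ n := fun N z => by
    simp [p, Polynomial.eval_finsetSum]
  have hsum : ∀ N, ∑ n ∈ Finset.range N, ‖c n‖ ^ 2 =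
      Real.circleAverage (fun z => ‖(p N).eval z‖ ^ 2) 0 1 := fun N => by
    have hco : ∀ i, (p N).coeff i = if i < N then c i else 0 := fun i => by
      simp [p, Polynomial.finsetSum_coeff, Polynomial.coeff_monomial]
    rw [← Polynomial.sum_sq_norm_coeff_eq_circleAverage]
    symm
    rw [Finset.sum_subset (s₂ := Finset.range N)]
    · refine Finset.sum_congr rfl fun i hi => ?_
      rw [hco, if_pos (Finset.mem_range.1 hi)]
    · intro i hi
      by_contra hN
      simp [hco] at hi hN
      omega
    · intro i _ hi
      rw [Polynomial.notMem_support_iff.1 hi]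
      simp
  simp_rw [hsum, Real.circleAverage_def]
  refine Filter.Tendsto.const_smul ?_ _
  refine intervalIntegral.tendsto_integral_filter_of_dominated_convergence
    (fun _ => (∑' n, ‖c n‖) ^ 2) ?_ ?_ ?_ ?_
  · refine Filter.Eventually.of_forall fun N => Continuous.aestronglyMeasurable ?_
    fun_prop
  · refine Filter.Eventually.of_forall fun N => Filter.Eventually.of_forall fun t _ => ?_
    rw [hev, norm_pow, norm_norm]
    gcongr
    refine (norm_sum_le _ _).trans ?_
    simp only [norm_mul, norm_pow, norm_circleMap_zero, abs_one, one_pow, mul_one]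
    exact hc.sum_le_tsum _ fun _ _ => norm_nonneg _
  · simp
  · refine Filter.Eventually.of_forall fun t _ => ?_
    simp_rw [hev]
    exact ((hφ _ (by simp)).tendsto_sum_nat.norm).pow 2

lemma ofReal_mul_mem_unitDisk {r : ℝ} (hr : 0 ≤ r) (hr1 : r < 1) {z : ℂ} (hz : ‖z‖ = 1) :
    (r : ℂ) * z ∈ unitDisk := by
  simpa [unitDisk, hz, abs_of_nonneg hr] using hr1

lemma hasSum_norm_sq_coef_mul_pow {g : ℂ → ℂ} (hg : DifferentiableOn ℂ g unitDisk) {r : ℝ}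
    (hr : 0 ≤ r) (hr1 : r < 1) :
    HasSum (fun n => ‖coef g n * (r : ℂ) ^ n‖ ^ 2)
      (Real.circleAverage (fun z => ‖g (r * z)‖ ^ 2) 0 1) := by
  refine parseval ?_ fun z hz => ?_
  · refine (coef_hasSum hg (z := r) ?_).summable.norm
    simpa using ofReal_mul_mem_unitDisk hr hr1 norm_one
  · simpa [mul_pow, mul_assoc] using coef_hasSum hg (ofReal_mul_mem_unitDisk hr hr1 hz)

lemma circleIntegrable_norm_sq {g : ℂ → ℂ} (hg : DifferentiableOn ℂ g unitDisk) {r : ℝ}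
    (hr : 0 ≤ r) (hr1 : r < 1) :
    CircleIntegrable (fun z => ‖g (r * z)‖ ^ 2) 0 1 := by
  refine ContinuousOn.circleIntegrable zero_le_one (ContinuousOn.pow (ContinuousOn.norm ?_) 2)
  refine hg.continuousOn.comp (by fun_prop) fun z hz => ?_
  exact ofReal_mul_mem_unitDisk hr hr1 (by simpa using hz)

lemma sum_norm_sq_coef_mul_le {a f : ℂ → ℂ} {C : ℝ} (ha : DifferentiableOn ℂ a unitDisk)
    (hC : ∀ z ∈ unitDisk, ‖a z‖ ≤ C) (hf : MemH2 f) (N : ℕ) :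
    ∑ n ∈ Finset.range N, ‖coef (fun z => a z * f z) n‖ ^ 2 ≤ C ^ 2 * ∑' n, ‖coef f n‖ ^ 2 := by
  have haf : DifferentiableOn ℂ (fun z => a z * f z) unitDisk := ha.mul hf.1
  have key : ∀ r : ℝ, 0 ≤ r → r < 1 →
      ∑ n ∈ Finset.range N, ‖coef (fun z => a z * f z) n * (r : ℂ) ^ n‖ ^ 2 ≤
        C ^ 2 * ∑' n, ‖coef f n‖ ^ 2 := fun r hr hr1 => by
    have h1 := hasSum_norm_sq_coef_mul_pow haf hr hr1
    have h2 := hasSum_norm_sq_coef_mul_pow hf.1 hr hr1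
    refine (h1.summable.sum_le_tsum _ fun _ _ => by positivity).trans ?_
    rw [h1.tsum_eq]
    calc _ ≤ Real.circleAverage (fun z => C ^ 2 • ‖f (r * z)‖ ^ 2) 0 1 := by
          refine Real.circleAverage_mono (circleIntegrable_norm_sq haf hr hr1)
            ((circleIntegrable_norm_sq hf.1 hr hr1).const_smul) fun z hz => ?_
          rw [norm_mul, mul_pow, smul_eq_mul]
          gcongr
          exact hC _ (ofReal_mul_mem_unitDisk hr hr1 (by simpa using hz))
      _ = C ^ 2 * ∑' n, ‖coef f n * (r : ℂ) ^ n‖ ^ 2 := by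
          rw [Real.circleAverage_fun_smul, h2.tsum_eq, smul_eq_mul]
      _ ≤ _ := by
          refine mul_le_mul_of_nonneg_left (h2.summable.tsum_le_tsum (fun n => ?_) hf.2)
            (sq_nonneg C)
          rw [norm_mul]
          gcongr
          refine mul_le_of_le_one_right (norm_nonneg _) ?_
          rw [norm_pow, Complex.norm_real, Real.norm_of_nonneg hr]
          exact pow_le_one₀ hr hr1.le
  have hlim : Filter.Tendsto
      (fun r : ℝ => ∑ n ∈ Finset.range N, ‖coef (fun z => a z * f z) n * (r : ℂ) ^ n‖ ^ 2)
      (nhdsWithin 1 (Iio 1))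
      (nhds (∑ n ∈ Finset.range N, ‖coef (fun z => a z * f z) n‖ ^ 2)) := by
    have hc : Continuous fun r : ℝ =>
        ∑ n ∈ Finset.range N, ‖coef (fun z => a z * f z) n * (r : ℂ) ^ n‖ ^ 2 := by fun_prop
    simpa using (hc.tendsto 1).mono_left nhdsWithin_le_nhds
  refine le_of_tendsto hlim ?_
  filter_upwards [Ioo_mem_nhdsLT (zero_lt_one (α := ℝ))] with r hr using key r hr.1.le hr.2

lemma MemH2.mul {a f : ℂ → ℂ} (ha : MemHinf a) (hf : MemH2 f) :
    MemH2 fun z => a z * f z := by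
  obtain ⟨ha, C, hC⟩ := ha
  exact ⟨ha.mul hf.1, summable_of_sum_range_le (fun _ => by positivity)
    (sum_norm_sq_coef_mul_le ha hC hf)⟩

/-- The function on the disk with Taylor coefficients `c`. -/
def powSum (c : ℕ → ℂ) : ℂ → ℂ := fun z => ∑' n, c n * z ^ n

lemma hasSum_powSum {c : ℕ → ℂ} (hc : Summable fun n => ‖c n‖ ^ 2) {z : ℂ} (hz : z ∈ unitDisk) :
    HasSum (fun n => c n * z ^ n) (powSum c z) := by
  have hz' : ‖z‖ < 1 := by simpa [unitDisk] using hz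
  have hgeo : Summable fun n : ℕ => (‖z‖ ^ 2) ^ n :=
    summable_geometric_of_lt_one (by positivity) (pow_lt_one₀ (norm_nonneg _) hz' two_ne_zero)
  refine (Summable.of_norm_bounded (hc.add hgeo) fun n => ?_).hasSum
  rw [norm_mul, norm_pow, ← pow_mul, mul_comm 2 n, pow_mul]
  nlinarith [sq_nonneg (‖c n‖ - ‖z‖ ^ n), sq_nonneg ‖c n‖, sq_nonneg (‖z‖ ^ n)]

lemma coef_powSum {c : ℕ → ℂ} (hc : Summable fun n => ‖c n‖ ^ 2) : coef (powSum c) = c :=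
  coef_eq_of_hasSum fun _ hz => hasSum_powSum hc hz

lemma memH2_powSum {c : ℕ → ℂ} (hc : Summable fun n => ‖c n‖ ^ 2) : MemH2 (powSum c) :=
  ⟨differentiableOn_of_hasSum fun _ hz => hasSum_powSum hc hz, by rwa [coef_powSum hc]⟩

/-- Square-summable sequences. -/
abbrev Ell2 : Type := lp (fun _ : ℕ => ℂ) 2

lemma Ell2.summable (x : Ell2) : Summable fun n => ‖x n‖ ^ 2 := by
  simpa using lp.memℓp x |>.summable (by simp)

lemma Ell2.norm_sq (x : Ell2) : ‖x‖ ^ 2 = ∑' n, ‖x n‖ ^ 2 := by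
  simpa using lp.norm_rpow_eq_tsum (p := 2) (by simp) x

/-- A square-summable sequence as an element of `Ell2`. -/
def Ell2.mk (c : ℕ → ℂ) (hc : Summable fun n => ‖c n‖ ^ 2) : Ell2 :=
  ⟨c, (memℓp_gen_iff (by simp)).2 (by simpa using hc)⟩

/-- `T` is the analytic Toeplitz operator with coefficient sequence `b`. -/
def IsToeplitz (b : ℕ → ℂ) (T : Ell2 →L[ℂ] Ell2) : Prop :=
  ∀ x n, T x n = ∑ i ∈ Finset.range (n + 1), b i * x (n - i)

lemma MemHinf.exists_isToeplitz {a : ℂ → ℂ} (ha : MemHinf a) : ∃ T, IsToeplitz (coef a) T := by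
  obtain ⟨C, hC⟩ := ha.2
  have hC0 : 0 ≤ C := (norm_nonneg _).trans (hC 0 (by simp [unitDisk]))
  have hcoef : ∀ x : Ell2, coef (fun z => a z * powSum x z) =
      fun n => ∑ i ∈ Finset.range (n + 1), coef a i * x (n - i) := fun x => by
    funext n
    rw [coef_mul ha.1 (memH2_powSum x.summable).1, coef_powSum x.summable]
  have hsum : ∀ x : Ell2, Summable fun n =>
      ‖∑ i ∈ Finset.range (n + 1), coef a i * x (n - i)‖ ^ 2 := fun x => by
    simpa only [hcoef] using ((memH2_powSum x.summable).mul ha).2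
  let L : Ell2 →ₗ[ℂ] Ell2 :=
    { toFun := fun x => Ell2.mk _ (hsum x)
      map_add' := fun x y => by
        ext n
        simp [Ell2.mk, mul_add, Finset.sum_add_distrib]
        rfl
      map_smul' := fun c x => by
        ext n
        simp [Ell2.mk, Finset.mul_sum, mul_left_comm] }
  refine ⟨L.mkContinuous C fun x => ?_, fun x n => rfl⟩
  refine le_of_sq_le_sq ?_ (by positivity)
  rw [mul_pow, Ell2.norm_sq, Ell2.norm_sq]
  have h := sum_norm_sq_coef_mul_le ha.1 hC (memH2_powSum x.summable)
  simp only [hcoef, coef_powSum x.summable] at h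
  exact Real.tsum_le_of_sum_range_le (fun _ => by positivity) h

/-- The standard basis vector of `Ell2` at `n`. -/
def Ell2.basis (n : ℕ) : Ell2 := lp.single 2 n 1

lemma Ell2.basis_apply (n m : ℕ) : Ell2.basis n m = if m = n then 1 else 0 := by
  simp [Ell2.basis, Pi.single_apply]

lemma Ell2.inner_basis_left (n : ℕ) (x : Ell2) : inner ℂ (Ell2.basis n) x = x n := by
  simp [Ell2.basis, lp.inner_single_left]

lemma Ell2.sum_smul_apply (s : Finset ℕ) (c : ℕ → ℂ) (x : ℕ → Ell2) (n : ℕ) :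
    (∑ i ∈ s, c i • x i : Ell2) n = ∑ i ∈ s, c i * x i n := by
  simp only [← Ell2.inner_basis_left n, inner_sum, inner_smul_right]

namespace IsToeplitz

variable {b : ℕ → ℂ} {T : Ell2 →L[ℂ] Ell2}

lemma apply_basis (hT : IsToeplitz b T) (n m : ℕ) :
    T (Ell2.basis n) m = if n ≤ m then b (m - n) else 0 := by
  rw [hT]
  simp only [Ell2.basis_apply, mul_ite, mul_one, mul_zero]
  split_ifs with h
  · rw [Finset.sum_eq_single (m - n)]
    · rw [if_pos (by omega)]
    · intro i hi hne
      rw [if_neg]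
      simp at hi
      omega
    · intro hi
      simp at hi
  · refine Finset.sum_eq_zero fun i _ => if_neg (by omega)

lemma adjoint_apply_eq_inner (y : Ell2) (n : ℕ) :
    T.adjoint y n = inner ℂ (T (Ell2.basis n)) y := by
  rw [← Ell2.inner_basis_left, ContinuousLinearMap.adjoint_inner_right]

lemma hasSum_adjoint_apply (hT : IsToeplitz b T) (y : Ell2) (n : ℕ) :
    HasSum (fun k => (starRingEnd ℂ) (b k) * y (n + k)) (T.adjoint y n) := by
  rw [adjoint_apply_eq_inner]
  have h := lp.hasSum_inner (𝕜 := ℂ) (T (Ell2.basis n)) y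
  rw [← (add_right_injective n).hasSum_iff] at h
  · simpa [Function.comp_def, hT.apply_basis, mul_comm] using h
  · intro m hm
    have : ¬ n ≤ m := fun h => hm ⟨m - n, by simp; omega⟩
    simp [hT.apply_basis, this]

lemma adjoint_apply_basis (n m : ℕ) :
    T.adjoint (Ell2.basis n) m = (starRingEnd ℂ) (T (Ell2.basis m) n) := by
  rw [adjoint_apply_eq_inner, ← inner_conj_symm, Ell2.inner_basis_left]

lemma inner_apply_basis_add (hT : IsToeplitz b T) (m n d : ℕ) :
    inner ℂ (T (Ell2.basis (m + d))) (T (Ell2.basis (n + d))) =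
      inner ℂ (T (Ell2.basis m)) (T (Ell2.basis n)) := by
  rw [lp.inner_eq_tsum, lp.inner_eq_tsum, ← (add_left_injective d).tsum_eq]
  · refine tsum_congr fun k => ?_
    simp only [hT.apply_basis, add_le_add_iff_right, Nat.add_sub_add_right]
  · intro k hk
    by_contra hkd
    have : ¬ m + d ≤ k := fun h => hkd ⟨k - d, by simp; omega⟩
    simp [hT.apply_basis, this] at hk

lemma inner_apply_basis_reflect (hT : IsToeplitz b T) {m n N : ℕ} (hm : m < N) (hn : n < N) :
    inner ℂ (T (Ell2.basis (N - 1 - m))) (T (Ell2.basis (N - 1 - n))) =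
      inner ℂ (T (Ell2.basis n)) (T (Ell2.basis m)) := by
  rcases le_total m n with h | h
  · obtain ⟨d, rfl⟩ := Nat.exists_eq_add_of_le h
    have h1 := hT.inner_apply_basis_add d 0 (N - 1 - (m + d))
    have h2 := hT.inner_apply_basis_add d 0 m
    rw [show d + (N - 1 - (m + d)) = N - 1 - m by omega, zero_add] at h1
    rw [show d + m = m + d by omega, zero_add] at h2
    rw [h1, h2]
  · obtain ⟨d, rfl⟩ := Nat.exists_eq_add_of_le h
    have h1 := hT.inner_apply_basis_add 0 d (N - 1 - (n + d))
    have h2 := hT.inner_apply_basis_add 0 d n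
    rw [show d + (N - 1 - (n + d)) = N - 1 - n by omega, zero_add] at h1
    rw [show d + n = n + d by omega, zero_add] at h2
    rw [h1, h2]

lemma norm_apply_reflect (hT : IsToeplitz b T) (c : ℕ → ℂ) (N : ℕ) :
    ‖T (∑ i ∈ Finset.range N, (starRingEnd ℂ) (c (N - 1 - i)) • Ell2.basis i)‖ =
      ‖T (∑ i ∈ Finset.range N, c i • Ell2.basis i)‖ := by
  have hrefl : ∑ i ∈ Finset.range N, (starRingEnd ℂ) (c (N - 1 - i)) • Ell2.basis i =
      ∑ i ∈ Finset.range N, (starRingEnd ℂ) (c i) • Ell2.basis (N - 1 - i) := by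
    rw [← Finset.sum_range_reflect]
    refine Finset.sum_congr rfl fun i hi => ?_
    rw [show N - 1 - (N - 1 - i) = i by have := Finset.mem_range.1 hi; omega]
  rw [hrefl, norm_eq_sqrt_re_inner (𝕜 := ℂ), norm_eq_sqrt_re_inner (𝕜 := ℂ)]
  congr 2
  simp only [map_sum, map_smul, sum_inner, inner_sum, inner_smul_left, inner_smul_right,
    Complex.conj_conj, Finset.mul_sum]
  rw [Finset.sum_comm]
  refine Finset.sum_congr rfl fun i hi => Finset.sum_congr rfl fun j hj => ?_
  rw [hT.inner_apply_basis_reflect (Finset.mem_range.1 hi) (Finset.mem_range.1 hj)]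
  ring

lemma norm_adjoint_apply_sum_le (hT : IsToeplitz b T) (c : ℕ → ℂ) (N : ℕ) :
    ‖T.adjoint (∑ i ∈ Finset.range N, c i • Ell2.basis i)‖ ≤
      ‖T (∑ i ∈ Finset.range N, c i • Ell2.basis i)‖ := by
  rw [← hT.norm_apply_reflect]
  set v := ∑ i ∈ Finset.range N, c i • Ell2.basis i
  set w := ∑ i ∈ Finset.range N, (starRingEnd ℂ) (c (N - 1 - i)) • Ell2.basis i
  have hv : ∀ n, T.adjoint v n =
      ∑ i ∈ Finset.range N, c i * (starRingEnd ℂ) (T (Ell2.basis n) i) := fun n => by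
    simp only [v, map_sum, map_smul, Ell2.sum_smul_apply, adjoint_apply_basis]
  have hw : ∀ n, T w n =
      ∑ i ∈ Finset.range N, (starRingEnd ℂ) (c (N - 1 - i)) * T (Ell2.basis i) n := fun n => by
    simp only [w, map_sum, map_smul, Ell2.sum_smul_apply]
  have hvw : ∀ n < N, ‖T.adjoint v n‖ = ‖T w (N - 1 - n)‖ := fun n hn => by
    rw [← Complex.norm_conj, hv, hw, ← Finset.sum_range_reflect, map_sum]
    congr 1
    refine Finset.sum_congr rfl fun i hi => ?_
    have hi' := Finset.mem_range.1 hi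
    rw [map_mul, Complex.conj_conj, hT.apply_basis, hT.apply_basis]
    congr 1
    by_cases h : n ≤ N - 1 - i
    · rw [if_pos h, if_pos (by omega)]
      congr 1
      omega
    · rw [if_neg h, if_neg (by omega)]
  have hv0 : ∀ n ∉ Finset.range N, ‖T.adjoint v n‖ ^ 2 = 0 := fun n hn => by
    rw [hv, Finset.sum_eq_zero]
    · simp
    · intro i hi
      simp only [Finset.mem_range] at hi hn
      rw [hT.apply_basis, if_neg (by omega)]
      simp
  refine le_of_sq_le_sq ?_ (norm_nonneg _)
  rw [Ell2.norm_sq, Ell2.norm_sq, tsum_eq_sum hv0, ← Finset.sum_range_reflect]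
  refine le_trans (le_of_eq ?_) ((T w).summable.sum_le_tsum (Finset.range N)
    fun _ _ => by positivity)
  refine Finset.sum_congr rfl fun i hi => ?_
  have hi' := Finset.mem_range.1 hi
  rw [hvw _ (by omega), show N - 1 - (N - 1 - i) = i by omega]

/-- Analytic Toeplitz operators are hyponormal. -/
lemma norm_adjoint_apply_le (hT : IsToeplitz b T) (x : Ell2) : ‖T.adjoint x‖ ≤ ‖T x‖ := by
  have hx := (lp.hasSum_single (by simp) x).tendsto_sum_nat
  refine le_of_tendsto_of_tendsto' ((T.adjoint.continuous.tendsto x).comp hx).norm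
    ((T.continuous.tendsto x).comp hx).norm fun N => ?_
  have : ∑ i ∈ Finset.range N, lp.single 2 i (x i) =
      ∑ i ∈ Finset.range N, x i • Ell2.basis i := by
    refine Finset.sum_congr rfl fun i _ => ?_
    rw [Ell2.basis, ← lp.single_smul, smul_eq_mul, mul_one]
  simpa only [Function.comp_apply, this] using hT.norm_adjoint_apply_sum_le (fun i => x i) N

end IsToeplitz

/-- A Douglas-type range inclusion for hyponormal operators. -/
lemma exists_adjoint_apply_eq {H : Type*} [NormedAddCommGroup H] [InnerProductSpace ℂ H]
    [CompleteSpace H] {T : H →L[ℂ] H} (hT : ∀ x, ‖T.adjoint x‖ ≤ ‖T x‖) (y : H) :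
    ∃ h, T.adjoint h = T y := by
  obtain ⟨s, hs⟩ := T.toLinearMap.rangeRestrict.exists_rightInverse_of_surjective
    T.toLinearMap.range_rangeRestrict
  have hs' : ∀ w, T (s w) = w := fun w => congr_arg Subtype.val (LinearMap.congr_fun hs w)
  let φ : T.toLinearMap.range →L[ℂ] ℂ :=
    LinearMap.mkContinuous ((innerSL ℂ (T y)).toLinearMap ∘ₗ s) ‖y‖ fun w => by
      have : inner ℂ (T y) (s w) = inner ℂ y (T.adjoint (s w)) := by
        rw [ContinuousLinearMap.adjoint_inner_right]
      simp only [LinearMap.comp_apply, ContinuousLinearMap.coe_coe, innerSL_apply_apply, this]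
      refine (norm_inner_le_norm _ _).trans ?_
      gcongr
      simpa [hs'] using hT (s w)
  obtain ⟨ψ, hψ, -⟩ := exists_extension_norm_eq _ φ
  refine ⟨(InnerProductSpace.toDual ℂ H).symm ψ, ext_inner_right ℂ fun x => ?_⟩
  rw [ContinuousLinearMap.adjoint_inner_left, InnerProductSpace.toDual_symm_apply]
  have h1 := hψ ⟨T x, x, rfl⟩
  simp only at h1
  rw [h1]
  change inner ℂ (T y) (s ⟨T x, x, rfl⟩) = _
  rw [← sub_eq_zero, ← inner_sub_right, ← ContinuousLinearMap.adjoint_inner_right]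
  have h0 : T.adjoint (s ⟨T x, x, rfl⟩ - x) = 0 := by
    rw [← norm_le_zero_iff]
    refine (hT _).trans ?_
    simp [hs']
  rw [h0, inner_zero_right]

lemma IsToeplitz.Tbar_eq {a f : ℂ → ℂ} {T : Ell2 →L[ℂ] Ell2} (hT : IsToeplitz (coef a) T)
    (hf : MemH2 f) : Tbar a f = powSum (T.adjoint (Ell2.mk _ hf.2)) := by
  funext z
  refine tsum_congr fun n => ?_
  rw [(hT.hasSum_adjoint_apply _ n).tsum_eq.symm]
  rfl

lemma MemH2.Tbar {a f : ℂ → ℂ} (ha : MemHinf a) (hf : MemH2 f) : MemH2 (Tbar a f) := by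
  obtain ⟨T, hT⟩ := ha.exists_isToeplitz
  rw [hT.Tbar_eq hf]
  exact memH2_powSum (Ell2.summable _)

lemma MemH2.congr {f g : ℂ → ℂ} (hf : MemH2 f) (h : EqOn g f unitDisk) : MemH2 g := by
  refine ⟨hf.1.congr h, ?_⟩
  rw [coef_eq_of_hasSum fun z hz => h hz ▸ coef_hasSum hf.1 hz]
  exact hf.2

lemma MemMbar.memH2 {a g : ℂ → ℂ} (ha : MemHinf a) (hg : MemMbar a g) : MemH2 g := by
  obtain ⟨f, hf, hgf⟩ := hg
  exact (hf.Tbar ha).congr hgf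

/-- `a H² ⊆ M(ā)`. -/
lemma MemH2.memMbar_mul {a g : ℂ → ℂ} (ha : MemHinf a) (hg : MemH2 g) :
    MemMbar a fun z => a z * g z := by
  obtain ⟨T, hT⟩ := ha.exists_isToeplitz
  obtain ⟨h, hh⟩ := exists_adjoint_apply_eq hT.norm_adjoint_apply_le (Ell2.mk _ hg.2)
  have hH := memH2_powSum h.summable
  refine ⟨powSum h, hH, fun z hz => ?_⟩
  rw [hT.Tbar_eq hH]
  have : Ell2.mk _ hH.2 = h := by
    ext n
    exact congr_fun (coef_powSum h.summable) n
  rw [this, hh]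
  refine ((coef_hasSum (ha.1.mul hg.1) hz).unique ?_)
  convert hasSum_powSum (T (Ell2.mk _ hg.2)).summable hz using 3 with n
  rw [hT]
  exact coef_mul ha.1 hg.1 n

lemma MemMbar.add_smul {a f g : ℂ → ℂ} (ha : MemHinf a) (hf : MemMbar a f) (hg : MemMbar a g)
    (c : ℂ) : MemMbar a fun z => f z + c * g z := by
  obtain ⟨T, hT⟩ := ha.exists_isToeplitz
  obtain ⟨u, hu, hfu⟩ := hf
  obtain ⟨v, hv, hgv⟩ := hg
  have hs := (Ell2.mk _ hu.2 + c • Ell2.mk _ hv.2).summable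
  have hH := memH2_powSum hs
  refine ⟨_, hH, fun z hz => ?_⟩
  change f z + c * g z = _
  rw [hT.Tbar_eq hH, hfu hz, hgv hz, hT.Tbar_eq hu, hT.Tbar_eq hv]
  have : Ell2.mk _ hH.2 = Ell2.mk _ hu.2 + c • Ell2.mk _ hv.2 := by
    ext n
    exact congr_fun (coef_powSum hs) n
  rw [this, map_add, map_smul]
  refine HasSum.unique ?_ (hasSum_powSum (Ell2.summable _) hz)
  convert (hasSum_powSum (Ell2.summable _) hz).add
    ((hasSum_powSum (Ell2.summable _) hz).mul_left c) using 2 with n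
  change (_ + c * _) * _ = _
  ring

lemma MemMbar.congr {a f g : ℂ → ℂ} (hf : MemMbar a f) (h : EqOn g f unitDisk) : MemMbar a g := by
  obtain ⟨u, hu, hfu⟩ := hf
  exact ⟨u, hu, h.trans hfu⟩

lemma norm_le_normInf {a : ℂ → ℂ} (ha : MemHinf a) {z : ℂ} (hz : z ∈ unitDisk) :
    ‖a z‖ ≤ normInf a := by
  obtain ⟨C, hC⟩ := ha.2
  exact le_csSup ⟨C, by rintro _ ⟨w, hw, rfl⟩; exact hC w hw⟩ ⟨z, hz, rfl⟩

lemma one_sub_le_norm {a : ℂ → ℂ} (ha : MemHinf a) (lam : ℂ) {z : ℂ} (hz : z ∈ unitDisk) :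
    1 - ‖lam‖ * normInf a ≤ ‖1 - (starRingEnd ℂ) lam * a z‖ := by
  have h1 := norm_sub_norm_le (1 : ℂ) ((starRingEnd ℂ) lam * a z)
  rw [norm_one, norm_mul, Complex.norm_conj] at h1
  have := mul_le_mul_of_nonneg_left (norm_le_normInf ha hz) (norm_nonneg lam)
  linarith

/-- for `a ∈ H^∞` and `λ ∈ ℂ` with `|λ| < 1/‖a‖_∞`,
multiplication by `1/(1 - λ̄ a)` maps `M(ā)` onto `M(ā)`. -/
theorem stmt14 (a : ℂ → ℂ) (ha : MemHinf a) (lam : ℂ)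
    (hlam : ‖lam‖ * normInf a < 1) :
    ∀ g, (∃ f, MemMbar a f ∧
        ∀ z ∈ unitDisk, g z = f z / (1 - (starRingEnd ℂ) lam * a z)) ↔
      MemMbar a g := by
  intro g
  have hpos : 0 < 1 - ‖lam‖ * normInf a := by linarith
  have hne : ∀ z ∈ unitDisk, 1 - (starRingEnd ℂ) lam * a z ≠ 0 := fun z hz =>
    norm_pos_iff.1 (hpos.trans_le (one_sub_le_norm ha lam hz))
  constructor
  · rintro ⟨f, hf, hgf⟩
    have hinv : MemHinf fun z => (1 - (starRingEnd ℂ) lam * a z)⁻¹ := by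
      refine ⟨((differentiableOn_const _).sub ((differentiableOn_const _).mul ha.1)).inv hne,
        (1 - ‖lam‖ * normInf a)⁻¹, fun z hz => ?_⟩
      rw [norm_inv]
      exact inv_anti₀ hpos (one_sub_le_norm ha lam hz)
    have hg := (hf.memH2 ha).mul hinv
    refine (hf.add_smul ha (hg.memMbar_mul ha) ((starRingEnd ℂ) lam)).congr fun z hz => ?_
    have := hne z hz
    simp only [hgf z hz]
    field_simp
    ring
  · intro hg
    refine ⟨fun z => g z + -(starRingEnd ℂ) lam * (a z * g z),
      hg.add_smul ha ((hg.memH2 ha).memMbar_mul ha) _, fun z hz => ?_⟩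
    rw [eq_div_iff (hne z hz)]
    ring
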